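/- Let n ≥ 1. For every pair of functions f, g in the complex linear span of {φ_j : j ∈ ℍ_n}, one has ⟨f, g⟩_H = (1/(3n²)) Σ_{j ∈ ℍ_n} f(j/n) conj(g(j/n)), where j/n denotes the point (j₁/n, j₂/n, j₃/n). -/

import Mathlib

open MeasureTheory
open scoped Real Classical

noncomputable section

/-- `φ_j(t) = exp(2πi (j₁t₁ + j₂t₂ + j₃t₃)/3)` for `j ∈ ℤ³`, `t ∈ ℝ³`. -/
def phi (j : ℤ × ℤ × ℤ) (t : ℝ × ℝ × ℝ) : ℂ :=
  Complex.exp (2 * (Real.pi : ℂ) * Complex.I *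
    ((j.1 : ℂ) * (t.1 : ℂ) + (j.2.1 : ℂ) * (t.2.1 : ℂ) + (j.2.2 : ℂ) * (t.2.2 : ℂ)) / 3)

/-- `ℍ_n = {j ∈ ℍ : -n ≤ j₁ < n, -n ≤ j₂ < n, -n ≤ -j₃ < n}`. -/
def Hn (n : ℕ) : Set (ℤ × ℤ × ℤ) :=
  {j | j.1 + j.2.1 + j.2.2 = 0 ∧ -(n : ℤ) ≤ j.1 ∧ j.1 < n ∧
       -(n : ℤ) ≤ j.2.1 ∧ j.2.1 < n ∧ -(n : ℤ) ≤ -j.2.2 ∧ -j.2.2 < n}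

/-- `ℍ_n* = {j ∈ ℍ : -n ≤ j₁, j₂, j₃ ≤ n}`. -/
def Hstar (n : ℕ) : Set (ℤ × ℤ × ℤ) :=
  {j | j.1 + j.2.1 + j.2.2 = 0 ∧ -(n : ℤ) ≤ j.1 ∧ j.1 ≤ n ∧
       -(n : ℤ) ≤ j.2.1 ∧ j.2.1 ≤ n ∧ -(n : ℤ) ≤ j.2.2 ∧ j.2.2 ≤ n}

/-- `ℍ_n° = {j ∈ ℍ : -n < j₁, j₂, j₃ < n}`. -/
def Hcirc (n : ℕ) : Set (ℤ × ℤ × ℤ) :=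
  {j | j.1 + j.2.1 + j.2.2 = 0 ∧ -(n : ℤ) < j.1 ∧ j.1 < n ∧
       -(n : ℤ) < j.2.1 ∧ j.2.1 < n ∧ -(n : ℤ) < j.2.2 ∧ j.2.2 < n}

/-- The weights `c_j^{(n)}`: 1 on interior points, 1/2 on edge points, 1/3 on vertices. -/
def cwt (n : ℕ) (j : ℤ × ℤ × ℤ) : ℝ :=
  if -(n : ℤ) < j.1 ∧ j.1 < n ∧ -(n : ℤ) < j.2.1 ∧ j.2.1 < n ∧
      -(n : ℤ) < j.2.2 ∧ j.2.2 < n then 1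
  else if j.1 * j.2.1 * j.2.2 ≠ 0 then 1 / 2 else 1 / 3

/-- The point `j/n = (j₁/n, j₂/n, j₃/n)`. -/
def pt (n : ℕ) (j : ℤ × ℤ × ℤ) : ℝ × ℝ × ℝ :=
  ((j.1 : ℝ) / n, (j.2.1 : ℝ) / n, (j.2.2 : ℝ) / n)

/-- Homogeneous coordinates `t(x) = (-x₂/2 + √3 x₁/2, x₂, -x₂/2 - √3 x₁/2)`. -/
def Tmap (x : ℝ × ℝ) : ℝ × ℝ × ℝ :=
  (-x.2 / 2 + Real.sqrt 3 * x.1 / 2, x.2, -x.2 / 2 - Real.sqrt 3 * x.1 / 2)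

/-- The planar hexagon `Ω_H` (of area 2√3). -/
def OmegaH : Set (ℝ × ℝ) :=
  {x | -1 ≤ (Tmap x).1 ∧ (Tmap x).1 < 1 ∧ -1 ≤ (Tmap x).2.1 ∧ (Tmap x).2.1 < 1 ∧
       -1 ≤ -(Tmap x).2.2 ∧ -(Tmap x).2.2 < 1}

/-- `⟨f,g⟩_H = (1/(2√3)) ∫_{Ω_H} f(t(x)) conj(g(t(x))) dx`. -/
def innerH (f g : ℝ × ℝ × ℝ → ℂ) : ℂ :=
  ((1 / (2 * Real.sqrt 3) : ℝ) : ℂ) *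
    ∫ x in OmegaH, f (Tmap x) * (starRingEnd ℂ) (g (Tmap x))

/-- `φ_m` as a function of the two free coordinates on the plane `t₁ + t₂ + t₃ = 0`. -/
def phiPlane (m : ℤ × ℤ × ℤ) (t s : ℝ) : ℂ := phi m (t, s, -t - s)

lemma continuous_phi (j : ℤ × ℤ × ℤ) : Continuous (phi j) := by
  unfold phi
  fun_prop

lemma continuous_of_mem_span_phi {S : Set (ℤ × ℤ × ℤ)} {f : ℝ × ℝ × ℝ → ℂ}
    (hf : f ∈ Submodule.span ℂ {F | ∃ j ∈ S, F = phi j}) : Continuous f := by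
  induction hf using Submodule.span_induction with
  | mem x h => obtain ⟨j, -, rfl⟩ := h; exact continuous_phi j
  | zero => exact continuous_const
  | add x y _ _ hx hy => exact hx.add hy
  | smul c x _ hx => exact hx.const_smul c

lemma phi_mul_conj (j k : ℤ × ℤ × ℤ) (t : ℝ × ℝ × ℝ) :
    phi j t * (starRingEnd ℂ) (phi k t) = phi (j - k) t := by
  unfold phi
  rw [← Complex.exp_conj, ← Complex.exp_add]
  congr 1
  simp only [map_div₀, map_mul, map_add, Complex.conj_ofReal, Complex.conj_I, map_ofNat,
    map_intCast, Prod.fst_sub, Prod.snd_sub, Int.cast_sub]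
  ring

lemma phiPlane_eq {m : ℤ × ℤ × ℤ} (hm : m.1 + m.2.1 + m.2.2 = 0) (t s : ℝ) :
    phiPlane m t s = Complex.exp (2 * Real.pi * Complex.I * ((2 * m.1 + m.2.1 : ℤ) : ℂ) / 3 * t) *
      Complex.exp (2 * Real.pi * Complex.I * ((m.1 + 2 * m.2.1 : ℤ) : ℂ) / 3 * s) := by
  have h3 : m.2.2 = -m.1 - m.2.1 := by omega
  unfold phiPlane phi
  rw [← Complex.exp_add, h3]
  congr 1
  push_cast
  ring

lemma phiPlane_add_one {m : ℤ × ℤ × ℤ} (hm : m.1 + m.2.1 + m.2.2 = 0) (t s : ℝ) :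
    phiPlane m (t + 1) (s + 1) = phiPlane m t s := by
  rw [phiPlane_eq hm, phiPlane_eq hm, ← Complex.exp_add, ← Complex.exp_add,
    Complex.exp_eq_exp_iff_exists_int]
  refine ⟨m.1 + m.2.1, ?_⟩
  push_cast
  ring

lemma continuous_phiPlane (m : ℤ × ℤ × ℤ) : Continuous (Function.uncurry (phiPlane m)) := by
  unfold Function.uncurry phiPlane
  exact (continuous_phi m).comp (by fun_prop)

lemma sub_mem_plane {n : ℕ} {j k : ℤ × ℤ × ℤ} (hj : j ∈ Hn n) (hk : k ∈ Hn n) :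
    (j - k).1 + (j - k).2.1 + (j - k).2.2 = 0 := by
  have h1 := hj.1
  have h2 := hk.1
  simp only [Prod.fst_sub, Prod.snd_sub]
  omega

/-! ### The integral over the hexagon -/

lemma measurableSet_OmegaH : MeasurableSet OmegaH := by
  unfold OmegaH Tmap
  simp only [measurableSet_setOfPred]
  measurability

lemma continuous_Tmap : Continuous Tmap := by
  unfold Tmap
  fun_prop

lemma isBounded_OmegaH : Bornology.IsBounded OmegaH := by
  refine (Metric.isBounded_Icc ((-2 : ℝ), (-2 : ℝ)) (2, 2)).subset ?_
  rintro ⟨x, y⟩ ⟨h1, h2, h3, h4, -, -⟩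
  simp only [Tmap] at h1 h2 h3 h4
  have h5 : (1 : ℝ) ≤ Real.sqrt 3 := Real.one_le_sqrt.2 (by norm_num)
  have h6 : Real.sqrt 3 ^ 2 = 3 := Real.sq_sqrt (by norm_num)
  have h7 : (3 / 2 : ℝ) ≤ Real.sqrt 3 := Real.le_sqrt_of_sq_le (by norm_num)
  simp only [Set.mem_Icc, Prod.mk_le_mk]
  refine ⟨⟨?_, by linarith⟩, ?_, by linarith⟩ <;> nlinarith

lemma integrableOn_OmegaH {h : ℝ × ℝ → ℂ} (hh : Continuous h) : IntegrableOn h OmegaH :=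
  (hh.continuousOn.integrableOn_compact isBounded_OmegaH.isCompact_closure).mono_set
    subset_closure

/-- The hexagon in the coordinates `(t₁, t₂)`. -/
def hexagon : Set (ℝ × ℝ) :=
  {p | -1 ≤ p.1 ∧ p.1 < 1 ∧ -1 ≤ p.2 ∧ p.2 < 1 ∧ -1 ≤ p.1 + p.2 ∧ p.1 + p.2 < 1}

lemma setIntegral_OmegaH {H : ℝ × ℝ × ℝ → ℂ} (hH : Continuous H) :
    ∫ x in OmegaH, H (Tmap x) = ((2 / Real.sqrt 3 : ℝ) : ℂ) *
      ∫ s : ℝ, ∫ t : ℝ, hexagon.indicator (fun p => H (p.1, p.2, -p.1 - p.2)) (t, s) := by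
  have hint : IntegrableOn (fun x => H (Tmap x)) OmegaH :=
    integrableOn_OmegaH (hH.comp continuous_Tmap)
  rw [← integral_indicator measurableSet_OmegaH]
  rw [← integrable_indicator_iff measurableSet_OmegaH] at hint
  rw [Measure.volume_eq_prod, integral_prod_symm _ hint, ← integral_const_mul]
  congr 1
  ext s
  set K : ℝ → ℂ := fun t => hexagon.indicator (fun p => H (p.1, p.2, -p.1 - p.2)) (t, s) with hK
  have hpos : 0 < Real.sqrt 3 := Real.sqrt_pos.2 (by norm_num)
  have key : ∀ x : ℝ, OmegaH.indicator (fun x => H (Tmap x)) (x, s)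
      = K (Real.sqrt 3 / 2 * x - s / 2) := by
    intro x
    have e1 : Tmap (x, s) = (Real.sqrt 3 / 2 * x - s / 2, s,
        -(Real.sqrt 3 / 2 * x - s / 2) - s) := by
      simp only [Tmap, Prod.mk.injEq, true_and]
      constructor <;> ring
    have e2 : (x, s) ∈ OmegaH ↔ (Real.sqrt 3 / 2 * x - s / 2, s) ∈ hexagon := by
      simp only [OmegaH, hexagon, Set.mem_ofPred_eq, e1]
      ring_nf
    simp only [hK, Set.indicator_apply, e2, e1]
  simp_rw [key]
  rw [Measure.integral_comp_mul_left (fun y => K (y - s / 2)) (Real.sqrt 3 / 2),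
    integral_sub_right_eq_self K (s / 2), inv_div, abs_of_pos (by positivity),
    Complex.real_smul]

lemma integral_hexagon {h : ℝ → ℝ → ℂ} (hc : Continuous (Function.uncurry h))
    (hper : ∀ t s, h (t + 1) (s + 1) = h t s) :
    ∫ s : ℝ, ∫ t : ℝ, hexagon.indicator (fun p => h p.1 p.2) (t, s) =
      ∫ s in (0 : ℝ)..1, ∫ t in (-1 : ℝ)..2, h t s := by
  have hc1 : ∀ s, Continuous fun t => h t s := fun s =>
    hc.comp (Continuous.prodMk_left s)
  have hc' : Continuous (Function.uncurry fun s t => h t s) := hc.comp continuous_swap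
  set A : ℝ → ℂ := fun s => ∫ t in (-1 - s)..1, h t s with hA
  set B : ℝ → ℂ := fun s => ∫ t in (-1)..(1 - s), h t s with hB
  have cB : Continuous B :=
    intervalIntegral.continuous_parametric_intervalIntegral_of_continuous hc' (by fun_prop)
  have cA : Continuous A := by
    have : A = fun s => -∫ t in (1)..(-1 - s), h t s := by
      ext s; rw [hA]; exact intervalIntegral.integral_symm _ _
    rw [this]
    exact (intervalIntegral.continuous_parametric_intervalIntegral_of_continuous hc'
      (by fun_prop)).neg
  have slice : ∀ s, ∫ t : ℝ, hexagon.indicator (fun p => h p.1 p.2) (t, s) =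
      (Set.Ico (-1 : ℝ) 0).indicator A s + (Set.Ico (0 : ℝ) 1).indicator B s := by
    intro s
    have gen : ∀ a b : ℝ, a ≤ b → (∀ t, (t, s) ∈ hexagon ↔ t ∈ Set.Ico a b) →
        ∫ t : ℝ, hexagon.indicator (fun p => h p.1 p.2) (t, s) = ∫ t in a..b, h t s := by
      intro a b hab hm
      rw [intervalIntegral.integral_of_le hab, ← integral_Ico_eq_integral_Ioc,
        ← integral_indicator measurableSet_Ico]
      congr 1
      ext t
      simp only [Set.indicator_apply, hm]
    by_cases h1 : s ∈ Set.Ico (-1 : ℝ) 0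
    · have h2 : s ∉ Set.Ico (0 : ℝ) 1 := fun h => absurd h.1 (not_le.2 h1.2)
      rw [Set.indicator_of_mem h1, Set.indicator_of_notMem h2, add_zero]
      obtain ⟨h3, h4⟩ := h1
      refine gen _ _ (by linarith) fun t => ?_
      simp only [hexagon, Set.mem_ofPred_eq, Set.mem_Ico]
      constructor
      · rintro ⟨_, _, _, _, _, _⟩; constructor <;> linarith
      · rintro ⟨_, _⟩; refine ⟨?_, ?_, ?_, ?_, ?_, ?_⟩ <;> linarith
    · rw [Set.indicator_of_notMem h1, zero_add]
      by_cases h2 : s ∈ Set.Ico (0 : ℝ) 1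
      · rw [Set.indicator_of_mem h2]
        obtain ⟨h3, h4⟩ := h2
        refine gen _ _ (by linarith) fun t => ?_
        simp only [hexagon, Set.mem_ofPred_eq, Set.mem_Ico]
        constructor
        · rintro ⟨_, _, _, _, _, _⟩; constructor <;> linarith
        · rintro ⟨_, _⟩; refine ⟨?_, ?_, ?_, ?_, ?_, ?_⟩ <;> linarith
      · rw [Set.indicator_of_notMem h2]
        have h3 : ∀ t, (t, s) ∉ hexagon := by
          rintro t ⟨-, -, h5, h6, -, -⟩
          simp only [Set.mem_Ico, not_and, not_lt] at h1 h2
          exact absurd h6 (not_lt.2 (h2 (h1 h5)))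
        simp [h3]
  have iA : Integrable ((Set.Ico (-1 : ℝ) 0).indicator A) :=
    (integrable_indicator_iff measurableSet_Ico).2
      (cA.integrableOn_Icc.mono_set Set.Ico_subset_Icc_self)
  have iB : Integrable ((Set.Ico (0 : ℝ) 1).indicator B) :=
    (integrable_indicator_iff measurableSet_Ico).2
      (cB.integrableOn_Icc.mono_set Set.Ico_subset_Icc_self)
  simp_rw [slice]
  rw [integral_add iA iB, integral_indicator measurableSet_Ico,
    integral_indicator measurableSet_Ico, integral_Ico_eq_integral_Ioc,
    integral_Ico_eq_integral_Ioc, ← intervalIntegral.integral_of_le (by norm_num),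
    ← intervalIntegral.integral_of_le (by norm_num)]
  have shift : ∫ s in (-1 : ℝ)..0, A s = ∫ s in (0 : ℝ)..1, A (s - 1) := by
    rw [intervalIntegral.integral_comp_sub_right]; norm_num
  have cA' : Continuous fun s => A (s - 1) := by fun_prop
  rw [shift, ← intervalIntegral.integral_add (cA'.intervalIntegrable _ _)
    (cB.intervalIntegrable _ _)]
  refine intervalIntegral.integral_congr fun s _ => ?_
  have hA' : A (s - 1) = ∫ t in (1 - s)..2, h t s := by
    have e : ∀ t, h t (s - 1) = h (t + 1) s := fun t => by
      rw [← hper t (s - 1), sub_add_cancel]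
    simp only [hA, e]
    rw [intervalIntegral.integral_comp_add_right (fun t => h t s)]
    congr 1 <;> ring
  change A (s - 1) + B s = _
  rw [hA', add_comm]
  exact intervalIntegral.integral_add_adjacent_intervals ((hc1 s).intervalIntegrable _ _)
    ((hc1 s).intervalIntegrable _ _)

lemma integral_exp_eq_zero {c : ℂ} (hc : c ≠ 0) {a b : ℝ}
    (h : ∃ k : ℤ, c * b = c * a + k * (2 * Real.pi * Complex.I)) :
    ∫ t in a..b, Complex.exp (c * t) = 0 := by
  rw [integral_exp_mul_complex hc, Complex.exp_eq_exp_iff_exists_int.2 h, sub_self, zero_div]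

lemma innerH_phi {j k : ℤ × ℤ × ℤ} (hm : (j - k).1 + (j - k).2.1 + (j - k).2.2 = 0) :
    innerH (phi j) (phi k) = if j = k then 1 else 0 := by
  have hpos : 0 < Real.sqrt 3 := Real.sqrt_pos.2 (by norm_num)
  unfold innerH
  simp_rw [phi_mul_conj]
  rw [setIntegral_OmegaH (continuous_phi _)]
  have := integral_hexagon (continuous_phiPlane (j - k)) (phiPlane_add_one hm)
  simp only [phiPlane] at this
  rw [this]
  split_ifs with hjk
  · subst hjk
    have h1 : ∀ t, phi (j - j) t = 1 := fun t => by simp [phi]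
    simp only [h1, intervalIntegral.integral_const]
    have h6 : Real.sqrt 3 * Real.sqrt 3 = 3 := Real.mul_self_sqrt (by norm_num)
    have h7 : (1 / (2 * Real.sqrt 3)) * (2 / Real.sqrt 3 * 3) = 1 := by
      field_simp
      nlinarith
    have h8 := congrArg (fun x : ℝ => (x : ℂ)) h7
    norm_num at h8 ⊢
    linear_combination h8
  · set m := j - k with hmdef
    have hm0 : ¬ (m.1 = 0 ∧ m.2.1 = 0) := by
      rintro ⟨h1, h2⟩
      have h3 : m.2.2 = 0 := by omega
      exact hjk (sub_eq_zero.1 (Prod.ext h1 (Prod.ext h2 h3)))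
    have h0 : ∫ s in (0 : ℝ)..1, ∫ t in (-1 : ℝ)..2, phi m (t, s, -t - s) = 0 := by
      change ∫ s in (0 : ℝ)..1, ∫ t in (-1 : ℝ)..2, phiPlane m t s = 0
      simp_rw [phiPlane_eq hm, intervalIntegral.integral_mul_const]
      rw [intervalIntegral.integral_const_mul]
      have hpi : (2 * Real.pi * Complex.I : ℂ) ≠ 0 := Complex.two_pi_I_ne_zero
      by_cases ha : 2 * m.1 + m.2.1 = 0
      · have hb : m.1 + 2 * m.2.1 ≠ 0 := by omega
        rw [integral_exp_eq_zero (a := 0) (b := 1), mul_zero]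
        · exact div_ne_zero (mul_ne_zero hpi (Int.cast_ne_zero.2 hb)) (by norm_num)
        · refine ⟨-m.1, ?_⟩
          have : m.2.1 = -2 * m.1 := by omega
          rw [this]
          push_cast
          ring
      · rw [integral_exp_eq_zero (a := -1) (b := 2), zero_mul]
        · exact div_ne_zero (mul_ne_zero hpi (Int.cast_ne_zero.2 ha)) (by norm_num)
        · refine ⟨2 * m.1 + m.2.1, ?_⟩
          push_cast
          ring
    rw [h0, mul_zero, mul_zero]

/-! ### The discrete sum -/

lemma finite_Hn (n : ℕ) : (Hn n).Finite := by
  refine (Set.finite_Icc ((-n : ℤ), (-n : ℤ), (-n : ℤ)) (n, n, n)).subset ?_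
  rintro ⟨a, b, c⟩ ⟨_, _, _, _, _, _, _⟩
  simp only [Set.mem_Icc, Prod.mk_le_mk] at *
  omega

/-- A sum over `ℍ_n` unfolds to a sum over a `3n × n` box of lattice points. -/
lemma finsum_Hn (n : ℕ) (F : ℤ × ℤ × ℤ → ℂ) (G : ℕ → ℕ → ℂ)
    (h1 : ∀ j ∈ Hn n, 0 ≤ j.2.1 → F j = G (j.1 + n).toNat j.2.1.toNat)
    (h2 : ∀ j ∈ Hn n, j.2.1 < 0 → F j = G (j.1 + 2 * n).toNat (j.2.1 + n).toNat) :
    ∑ᶠ j ∈ Hn n, F j = ∑ p ∈ Finset.range (3 * n), ∑ q ∈ Finset.range n, G p q := by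
  rw [finsum_mem_eq_finite_toFinset_sum _ (finite_Hn n), ← Finset.sum_product']
  refine Finset.sum_bij'
    (fun j _ => if j.2.1 < 0 then ((j.1 + 2 * n).toNat, (j.2.1 + n).toNat)
      else ((j.1 + n).toNat, j.2.1.toNat))
    (fun p _ => if p.1 + p.2 < 2 * n then
        ((p.1 : ℤ) - n, (p.2 : ℤ), (n : ℤ) - p.1 - p.2)
      else ((p.1 : ℤ) - 2 * n, (p.2 : ℤ) - n, 3 * (n : ℤ) - p.1 - p.2)) ?_ ?_ ?_ ?_ ?_
  · rintro ⟨a, b, c⟩ h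
    simp only [Set.Finite.mem_toFinset, Hn, Set.mem_ofPred_eq] at h
    simp only [Finset.mem_product, Finset.mem_range]
    split_ifs <;> dsimp only <;> omega
  · rintro ⟨p, q⟩ h
    simp only [Finset.mem_product, Finset.mem_range] at h
    simp only [Set.Finite.mem_toFinset, Hn, Set.mem_ofPred_eq]
    split_ifs <;> dsimp only at * <;> omega
  · rintro ⟨a, b, c⟩ h
    simp only [Set.Finite.mem_toFinset, Hn, Set.mem_ofPred_eq] at h
    dsimp only
    split_ifs <;> simp only [Prod.mk.injEq] <;> dsimp only at * <;> omega
  · rintro ⟨p, q⟩ h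
    simp only [Finset.mem_product, Finset.mem_range] at h
    dsimp only
    split_ifs <;> simp only [Prod.mk.injEq] <;> dsimp only at * <;> omega
  · intro j h
    rw [Set.Finite.mem_toFinset] at h
    split_ifs with hj
    · exact h2 j h hj
    · exact h1 j h (not_lt.1 hj)

lemma geom_sum_eq_zero_of_pow_eq_one {z : ℂ} {N : ℕ} (hz : z ≠ 1) (hN : z ^ N = 1) :
    ∑ p ∈ Finset.range N, z ^ p = 0 := by
  rw [geom_sum_eq hz, hN, sub_self, zero_div]

lemma dvd_of_exp_eq_one {N : ℕ} (hN : N ≠ 0) {a : ℤ}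
    (h : Complex.exp (2 * Real.pi * Complex.I * a / N) = 1) : (N : ℤ) ∣ a := by
  obtain ⟨k, hk⟩ := Complex.exp_eq_one_iff.1 h
  have hN' : (N : ℂ) ≠ 0 := Nat.cast_ne_zero.2 hN
  refine ⟨k, ?_⟩
  rw [div_eq_iff hN'] at hk
  have : (a : ℂ) = N * k :=
    mul_left_cancel₀ Complex.two_pi_I_ne_zero (by rw [hk]; ring)
  exact_mod_cast this

lemma eq_of_dvd {n : ℕ} (hn : 1 ≤ n) {j k : ℤ × ℤ × ℤ} (hj : j ∈ Hn n) (hk : k ∈ Hn n)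
    (ha : ((3 * n : ℕ) : ℤ) ∣ 2 * (j - k).1 + (j - k).2.1)
    (hb : ((3 * n : ℕ) : ℤ) ∣ (j - k).1 + 2 * (j - k).2.1) : j = k := by
  obtain ⟨u, hu⟩ := ha
  obtain ⟨v, hv⟩ := hb
  obtain ⟨j1, j2, j3⟩ := j
  obtain ⟨k1, k2, k3⟩ := k
  simp only [Hn, Set.mem_ofPred_eq] at hj hk
  simp only [Prod.mk_sub_mk] at hu hv
  have hn' : (0 : ℤ) < n := by omega
  push_cast at hu hv
  have e1 : j1 - k1 = n * (2 * u - v) := by linarith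
  have e2 : j2 - k2 = n * (2 * v - u) := by linarith
  have e3 : (j1 + j2) - (k1 + k2) = n * (u + v) := by linarith
  have bound : ∀ x : ℤ, n * x < n * 2 → n * (-2) < n * x → x < 2 ∧ -2 < x := fun x h1 h2 =>
    ⟨lt_of_mul_lt_mul_left h1 hn'.le, lt_of_mul_lt_mul_left h2 hn'.le⟩
  have b1 := bound (2 * u - v) (by linarith) (by linarith)
  have b2 := bound (2 * v - u) (by linarith) (by linarith)
  have b3 := bound (u + v) (by linarith) (by linarith)
  have hu0 : u = 0 := by omega
  have hv0 : v = 0 := by omega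
  subst hu0 hv0
  simp only [Prod.mk.injEq]
  refine ⟨?_, ?_, ?_⟩ <;> linarith

lemma finsum_phi {n : ℕ} (hn : 1 ≤ n) {j k : ℤ × ℤ × ℤ} (hj : j ∈ Hn n) (hk : k ∈ Hn n) :
    ∑ᶠ l ∈ Hn n, phi j (pt n l) * (starRingEnd ℂ) (phi k (pt n l)) =
      if j = k then 3 * (n : ℂ) ^ 2 else 0 := by
  have hm := sub_mem_plane hj hk
  have hN : 3 * n ≠ 0 := by omega
  have hn0 : (n : ℂ) ≠ 0 := Nat.cast_ne_zero.2 (by omega)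
  simp_rw [phi_mul_conj]
  set m := j - k with hmdef
  set a : ℤ := 2 * m.1 + m.2.1 with ha
  set b : ℤ := m.1 + 2 * m.2.1 with hb
  set z : ℂ := Complex.exp (2 * Real.pi * Complex.I * a / (3 * n : ℕ)) with hz
  set w : ℂ := Complex.exp (2 * Real.pi * Complex.I * b / (3 * n : ℕ)) with hw
  set C : ℂ := Complex.exp (-(2 * Real.pi * Complex.I * a / 3)) with hC
  have hval : ∀ p q : ℕ, C * (z ^ p * w ^ q) = Complex.exp (-(2 * Real.pi * Complex.I * a / 3) +
      (p * (2 * Real.pi * Complex.I * a / (3 * n : ℕ)) +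
        q * (2 * Real.pi * Complex.I * b / (3 * n : ℕ)))) := fun p q => by
    rw [Complex.exp_add, Complex.exp_add, Complex.exp_nat_mul, Complex.exp_nat_mul]
  have hm3 : m.2.2 = -m.1 - m.2.1 := by omega
  rw [finsum_Hn n _ fun p q => C * (z ^ p * w ^ q)]
  rotate_left
  · rintro ⟨l1, l2, l3⟩ ⟨hl, hl1, -⟩ hl2
    dsimp only at hl hl1 hl2 ⊢
    obtain ⟨p, hp⟩ := Int.eq_ofNat_of_zero_le (by omega : 0 ≤ l1 + n)
    obtain ⟨q, hq⟩ := Int.eq_ofNat_of_zero_le hl2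
    rw [hval, hp, hq, Int.toNat_natCast, Int.toNat_natCast, phi, pt]
    have e1 : l1 = p - n := by omega
    have e3 : l3 = n - p - q := by omega
    rw [e1, e3, hm3]
    congr 1
    simp only [ha, hb]
    push_cast
    field_simp
    ring
  · rintro ⟨l1, l2, l3⟩ ⟨hl, hl1, -, hl2, -, -, hl3⟩ hl4
    dsimp only at hl hl1 hl2 hl3 hl4 ⊢
    obtain ⟨p, hp⟩ := Int.eq_ofNat_of_zero_le (by omega : 0 ≤ l1 + 2 * n)
    obtain ⟨q, hq⟩ := Int.eq_ofNat_of_zero_le (by omega : 0 ≤ l2 + n)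
    rw [hval, hp, hq, Int.toNat_natCast, Int.toNat_natCast, phi, pt]
    have e1 : l1 = p - 2 * n := by omega
    have e2 : l2 = q - n := by omega
    have e3 : l3 = 3 * n - p - q := by omega
    rw [e1, e2, e3, hm3, Complex.exp_eq_exp_iff_exists_int]
    refine ⟨-(m.1 + m.2.1), ?_⟩
    simp only [ha, hb]
    push_cast
    field_simp
    ring
  simp_rw [← Finset.mul_sum]
  rw [← Finset.sum_mul]
  split_ifs with hjk
  · have hm0 : m = 0 := by rw [hmdef, hjk, sub_self]
    have ha0 : a = 0 := by simp [ha, hm0]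
    have hb0 : b = 0 := by simp [hb, hm0]
    simp [hz, hw, hC, ha0, hb0]
    ring
  · by_cases hz1 : z = 1
    · have hda := dvd_of_exp_eq_one hN hz1
      have hw1 : w ≠ 1 := fun h => hjk (eq_of_dvd hn hj hk hda (dvd_of_exp_eq_one hN h))
      rw [geom_sum_eq_zero_of_pow_eq_one hw1, mul_zero, mul_zero]
      obtain ⟨u, hu⟩ := hda
      rw [hw, ← Complex.exp_nat_mul, Complex.exp_eq_one_iff]
      refine ⟨2 * n * u - m.1, ?_⟩
      have hb' : b = 2 * (3 * n * u) - 3 * m.1 := by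
        push_cast at hu
        linarith
      rw [hb']
      push_cast
      field_simp
    · rw [geom_sum_eq_zero_of_pow_eq_one hz1, zero_mul, mul_zero]
      rw [hz, ← Complex.exp_nat_mul, Complex.exp_eq_one_iff]
      refine ⟨a, ?_⟩
      push_cast
      field_simp

/-! ### Sesquilinearity -/

lemma innerH_add_left {f₁ f₂ g : ℝ × ℝ × ℝ → ℂ} (h₁ : Continuous f₁) (h₂ : Continuous f₂)
    (hg : Continuous g) : innerH (f₁ + f₂) g = innerH f₁ g + innerH f₂ g := by
  have cT := continuous_Tmap
  unfold innerH
  rw [← mul_add, ← integral_add (integrableOn_OmegaH (by fun_prop))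
    (integrableOn_OmegaH (by fun_prop))]
  simp only [Pi.add_apply, add_mul]

lemma innerH_smul_left (c : ℂ) (f g : ℝ × ℝ × ℝ → ℂ) :
    innerH (c • f) g = c * innerH f g := by
  unfold innerH
  simp only [Pi.smul_apply, smul_eq_mul, mul_assoc, integral_const_mul]
  ring

lemma innerH_conj_symm (f g : ℝ × ℝ × ℝ → ℂ) :
    (starRingEnd ℂ) (innerH f g) = innerH g f := by
  unfold innerH
  rw [map_mul, Complex.conj_ofReal, ← integral_conj]
  simp only [map_mul, Complex.conj_conj, mul_comm]

/-- The discrete inner product `(1/(3n²)) Σ_{j ∈ ℍ_n} f(j/n) conj(g(j/n))`. -/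
def discreteInner (n : ℕ) (f g : ℝ × ℝ × ℝ → ℂ) : ℂ :=
  ((1 / (3 * (n : ℝ) ^ 2) : ℝ) : ℂ) *
    ∑ᶠ j ∈ Hn n, f (pt n j) * (starRingEnd ℂ) (g (pt n j))

lemma discreteInner_add_left (n : ℕ) (f₁ f₂ g : ℝ × ℝ × ℝ → ℂ) :
    discreteInner n (f₁ + f₂) g = discreteInner n f₁ g + discreteInner n f₂ g := by
  unfold discreteInner
  rw [← mul_add, ← finsum_mem_add_distrib (finite_Hn n)]
  simp only [Pi.add_apply, add_mul]

lemma discreteInner_smul_left (n : ℕ) (c : ℂ) (f g : ℝ × ℝ × ℝ → ℂ) :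
    discreteInner n (c • f) g = c * discreteInner n f g := by
  unfold discreteInner
  simp only [finsum_mem_eq_finite_toFinset_sum _ (finite_Hn n), Pi.smul_apply, smul_eq_mul,
    mul_assoc, ← Finset.mul_sum]
  ring

lemma discreteInner_conj_symm (n : ℕ) (f g : ℝ × ℝ × ℝ → ℂ) :
    (starRingEnd ℂ) (discreteInner n f g) = discreteInner n g f := by
  unfold discreteInner
  simp only [finsum_mem_eq_finite_toFinset_sum _ (finite_Hn n)]
  rw [map_mul, Complex.conj_ofReal, map_sum]
  simp only [map_mul, Complex.conj_conj, mul_comm]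

lemma innerH_phi_eq_discreteInner {n : ℕ} (hn : 1 ≤ n) {j k : ℤ × ℤ × ℤ} (hj : j ∈ Hn n)
    (hk : k ∈ Hn n) : innerH (phi j) (phi k) = discreteInner n (phi j) (phi k) := by
  have hn0 : (n : ℂ) ≠ 0 := Nat.cast_ne_zero.2 (by omega)
  rw [innerH_phi (sub_mem_plane hj hk), discreteInner, finsum_phi hn hj hk]
  split_ifs
  · push_cast
    field_simp
  · rw [mul_zero]

lemma innerH_eq_discreteInner_of_left {n : ℕ} {S : Set (ℤ × ℤ × ℤ)} {f g : ℝ × ℝ × ℝ → ℂ}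
    (hg : Continuous g) (h : ∀ j ∈ S, innerH (phi j) g = discreteInner n (phi j) g)
    (hf : f ∈ Submodule.span ℂ {F | ∃ j ∈ S, F = phi j}) :
    innerH f g = discreteInner n f g := by
  induction hf using Submodule.span_induction with
  | mem x hx => obtain ⟨j, hj, rfl⟩ := hx; exact h j hj
  | zero => simp [innerH, discreteInner]
  | add x y hx hy ihx ihy =>
    rw [innerH_add_left (continuous_of_mem_span_phi hx) (continuous_of_mem_span_phi hy) hg,
      discreteInner_add_left, ihx, ihy]
  | smul c x _ ih => rw [innerH_smul_left, discreteInner_smul_left, ih]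

theorem stmt_3 (n : ℕ) (hn : 1 ≤ n) (f g : ℝ × ℝ × ℝ → ℂ)
    (hf : f ∈ Submodule.span ℂ {F | ∃ j ∈ Hn n, F = phi j})
    (hg : g ∈ Submodule.span ℂ {F | ∃ j ∈ Hn n, F = phi j}) :
    innerH f g =
      ((1 / (3 * (n : ℝ) ^ 2) : ℝ) : ℂ) *
        ∑ᶠ j ∈ Hn n, f (pt n j) * (starRingEnd ℂ) (g (pt n j)) := by
  refine innerH_eq_discreteInner_of_left (continuous_of_mem_span_phi hg) (fun j hj => ?_) hf
  rw [← innerH_conj_symm, ← discreteInner_conj_symm]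
  congr 1
  exact innerH_eq_discreteInner_of_left (continuous_phi j)
    (fun k hk => innerH_phi_eq_discreteInner hn hk hj) hg
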